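/- arXiv:1806.06740 — 8 statements merged into one kernel-verified Lean document; each statement's English description precedes it below -/
import Mathlib

section
/- Let c > 0 be a real constant, v a real constant, τ ∈ ℂ with Re τ > 0, and η ∈ ℝ. Then the equation s² = ((τ + i v η)/c)² + η² has exactly one solution s ∈ ℂ with Re s > 0; moreover the only other solution is −s. -/
/-- For c > 0 real, v real, τ ∈ ℂ with Re τ > 0, η ∈ ℝ, the equation
s² = ((τ + i v η)/c)² + η² has exactly one solution s with Re s > 0, and the only
other solution is −s. -/
theorem stmt_0 (c v : ℝ) (hc : 0 < c) (τ : ℂ) (hτ : 0 < τ.re) (η : ℝ) :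
    ∃ s : ℂ, 0 < s.re ∧
      s ^ 2 = ((τ + Complex.I * (v : ℂ) * (η : ℂ)) / (c : ℂ)) ^ 2 + (η : ℂ) ^ 2 ∧
      (∀ s' : ℂ, 0 < s'.re →
        s' ^ 2 = ((τ + Complex.I * (v : ℂ) * (η : ℂ)) / (c : ℂ)) ^ 2 + (η : ℂ) ^ 2 → s' = s) ∧
      (∀ s' : ℂ,
        s' ^ 2 = ((τ + Complex.I * (v : ℂ) * (η : ℂ)) / (c : ℂ)) ^ 2 + (η : ℂ) ^ 2 ↔
          s' = s ∨ s' = -s) := by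
  have hw : 0 < ((τ + Complex.I * (v : ℂ) * (η : ℂ)) / (c : ℂ)).re := by
    rw [Complex.div_ofReal_re]
    apply div_pos _ hc
    simpa using hτ
  generalize (τ + Complex.I * (v : ℂ) * (η : ℂ)) / (c : ℂ) = w at hw ⊢
  have key : ∀ z : ℂ, z ^ 2 = w ^ 2 + (η : ℂ) ^ 2 → z.re ≠ 0 := by
    intro z hz h0
    have h1 := congrArg Complex.re hz
    have h2 := congrArg Complex.im hz
    simp only [pow_two, Complex.add_re, Complex.add_im, Complex.mul_re, Complex.mul_im,
      Complex.ofReal_re, Complex.ofReal_im, h0] at h1 h2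
    have h3 : w.re * w.im = 0 := by linarith
    have h4 : w.im = 0 := (mul_eq_zero.mp h3).resolve_left hw.ne'
    rw [h4] at h1
    nlinarith [mul_pos hw hw, mul_self_nonneg η, mul_self_nonneg z.im]
  have ex : ∃ s : ℂ, 0 < s.re ∧ s ^ 2 = w ^ 2 + (η : ℂ) ^ 2 := by
    obtain ⟨z, hz⟩ := IsAlgClosed.exists_pow_nat_eq (w ^ 2 + (η : ℂ) ^ 2) (n := 2) (by norm_num)
    rcases lt_or_gt_of_ne (key z hz) with h | h
    · exact ⟨-z, by simpa using h, by rw [neg_sq, hz]⟩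
    · exact ⟨z, h, hz⟩
  obtain ⟨s, hs, hs2⟩ := ex
  refine ⟨s, hs, hs2, ?_, ?_⟩
  · intro t ht ht2
    rcases sq_eq_sq_iff_eq_or_eq_neg.mp (ht2.trans hs2.symm) with h | h
    · exact h
    · rw [h, Complex.neg_re] at ht
      linarith
  · intro t
    rw [← hs2]
    exact sq_eq_sq_iff_eq_or_eq_neg
end

section
/- Fix real constants c > 0 and v > 0, η̄ ∈ ℝ with η̄ ≠ 0, and δ̄ ∈ ℝ with δ̄/(c η̄) < −(v/c + 1). Then ((δ̄ + v η̄)/c)² − η̄² > 0, and μ⁺(τ,η) converges to the purely imaginary number −i · sgn(η̄) · √(((δ̄ + v η̄)/c)² − η̄²) as (τ,η) → (i δ̄, η̄) with (τ,η) ranging over {τ ∈ ℂ : Re τ > 0} × ℝ. -/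
/-- In the region δ̄/(cη̄) < −(v/c+1) (with η̄ ≠ 0), the radicand
((δ̄+vη̄)/c)² − η̄² is positive and μ⁺(τ,η) → −i·sgn(η̄)·√(((δ̄+vη̄)/c)² − η̄²)
as (τ,η) → (iδ̄, η̄) with Re τ > 0. -/
theorem stmt_2 (c v : ℝ) (hc : 0 < c) (hv : 0 < v)
    (ηb : ℝ) (hηb : ηb ≠ 0) (δb : ℝ)
    (h1 : δb / (c * ηb) < -(v / c + 1))
    (μp : ℂ → ℝ → ℂ)
    (hμp : ∀ (τ : ℂ) (η : ℝ), 0 < τ.re →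
      0 < (μp τ η).re ∧
        (μp τ η) ^ 2 = ((τ + Complex.I * (v : ℂ) * (η : ℂ)) / (c : ℂ)) ^ 2 + (η : ℂ) ^ 2) :
    0 < ((δb + v * ηb) / c) ^ 2 - ηb ^ 2 ∧
    Filter.Tendsto (fun p : ℂ × ℝ => μp p.1 p.2)
      (nhdsWithin (Complex.I * (δb : ℂ), ηb) {p : ℂ × ℝ | 0 < p.1.re})
      (nhds (-(Complex.I * (Real.sign ηb : ℂ) *
        (Real.sqrt (((δb + v * ηb) / c) ^ 2 - ηb ^ 2) : ℂ)))) := by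
  have hx : (δb + v * ηb) / c / ηb < -1 := by
    have e : (δb + v * ηb) / c / ηb = δb / (c * ηb) + v / c := by
      field_simp
    rw [e]; linarith
  set x := (δb + v * ηb) / c with hxd
  have hsq : 0 < x ^ 2 - ηb ^ 2 := by
    have e : x = (x / ηb) * ηb := by field_simp
    have h2 : 0 < ηb ^ 2 := by positivity
    have h3 : 1 < (x / ηb) ^ 2 := by nlinarith
    rw [e, mul_pow]
    nlinarith
  refine ⟨hsq, ?_⟩
  obtain ⟨s, hs⟩ : ∃ s, s = Real.sign ηb := ⟨_, rfl⟩
  have hs2 : s ^ 2 = 1 := by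
    rcases Real.sign_apply_eq_of_ne_zero ηb hηb with h | h <;> rw [hs, h] <;> norm_num
  have hsx : s * x < 0 := by
    have e : x = (x / ηb) * ηb := by field_simp
    have h4 : 0 < s * ηb := by rw [hs]; exact Real.sign_mul_pos_of_ne_zero ηb hηb
    have : s * x = (x / ηb) * (s * ηb) := by field_simp
    rw [this]
    exact mul_neg_of_neg_of_pos (by linarith) h4
  rw [← hs]
  obtain ⟨r, hr⟩ : ∃ r, r = Real.sqrt (x ^ 2 - ηb ^ 2) := ⟨_, rfl⟩
  have hr0 : 0 < r := by rw [hr]; exact Real.sqrt_pos.mpr hsq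
  have hr2 : r ^ 2 = x ^ 2 - ηb ^ 2 := by rw [hr]; exact Real.sq_sqrt hsq.le
  rw [← hr]
  set L : ℂ := -(Complex.I * (s : ℂ) * (r : ℂ)) with hL
  have hLim : L.im = -(s * r) := by simp [hL]
  have hL2 : L ^ 2 = -((x : ℂ) ^ 2 - (ηb : ℂ) ^ 2) := by
    have a : (s : ℂ) ^ 2 = 1 := by exact_mod_cast hs2
    have b : (r : ℂ) ^ 2 = (x : ℂ) ^ 2 - (ηb : ℂ) ^ 2 := by exact_mod_cast hr2
    rw [hL, neg_sq, mul_pow, mul_pow, a, b, Complex.I_sq]; ring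
  let w : ℂ × ℝ → ℂ := fun p =>
    ((p.1 + Complex.I * (v : ℂ) * (p.2 : ℂ)) / (c : ℂ)) ^ 2 + (p.2 : ℂ) ^ 2
  have hwc : Continuous w := by fun_prop
  have hw0 : w (Complex.I * (δb : ℂ), ηb) = L ^ 2 := by
    rw [hL2]
    have : (Complex.I * (δb : ℂ) + Complex.I * (v : ℂ) * (ηb : ℂ)) / (c : ℂ)
        = Complex.I * (x : ℂ) := by
      rw [hxd]; push_cast; ring
    simp only [w]
    rw [this, mul_pow, Complex.I_sq]; ring
  have hlim : Filter.Tendsto (fun p => ‖w p - L ^ 2‖ / r)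
      (nhdsWithin (Complex.I * (δb : ℂ), ηb) {p : ℂ × ℝ | 0 < p.1.re}) (nhds 0) := by
    have hc' : Continuous (fun p => ‖w p - L ^ 2‖ / r) := by fun_prop
    have := hc'.tendsto (Complex.I * (δb : ℂ), ηb)
    rw [hw0] at this
    simp only [sub_self, norm_zero, zero_div] at this
    exact this.mono_left nhdsWithin_le_nhds
  have hev : ∀ᶠ p : ℂ × ℝ in nhds (Complex.I * (δb : ℂ), ηb),
      s * ((p.1.im + v * p.2) / c) < 0 := by
    have hc' : Continuous (fun p : ℂ × ℝ => s * ((p.1.im + v * p.2) / c)) := by fun_prop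
    refine hc'.continuousAt.eventually_lt continuousAt_const ?_
    simpa [hxd] using hsx
  rw [tendsto_iff_norm_sub_tendsto_zero]
  refine squeeze_zero' (Filter.Eventually.of_forall fun _ => norm_nonneg _) ?_ hlim
  filter_upwards [nhdsWithin_le_nhds hev, self_mem_nhdsWithin] with p hp hre
  have hre : 0 < p.1.re := hre
  obtain ⟨hm, hm2⟩ := hμp p.1 p.2 hre
  set m := μp p.1 p.2
  have hw : m ^ 2 = w p := hm2
  have him : 2 * (m.re * m.im) = 2 * (p.1.re / c * ((p.1.im + v * p.2) / c)) := by
    have := congrArg Complex.im hm2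
    simp only [sq, Complex.add_im, Complex.mul_im, Complex.div_ofReal_re,
      Complex.div_ofReal_im, Complex.add_re, Complex.mul_re, Complex.I_re, Complex.I_im,
      Complex.ofReal_re, Complex.ofReal_im] at this
    ring_nf at this ⊢
    linarith
  have hsm : s * m.im < 0 := by
    have h5 : m.re * (s * m.im) = p.1.re / c * (s * ((p.1.im + v * p.2) / c)) := by
      linear_combination (s / 2) * him
    have h6 : m.re * (s * m.im) < 0 := by
      rw [h5]; exact mul_neg_of_pos_of_neg (by positivity) hp
    by_contra h
    push Not at h
    have := mul_nonneg hm.le h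
    linarith
  have hlow : r ≤ ‖m + L‖ := by
    refine le_trans ?_ (Complex.abs_im_le_norm _)
    rw [Complex.add_im, hLim]
    have hs1 : |s| = 1 := by
      rw [← sq_eq_sq₀ (abs_nonneg _) zero_le_one, sq_abs, hs2, one_pow]
    have : |m.im + -(s * r)| = |s * (m.im + -(s * r))| := by rw [abs_mul, hs1, one_mul]
    rw [this]
    have e : s * (m.im + -(s * r)) = s * m.im - r := by linear_combination (-r) * hs2
    rw [e]
    have := neg_abs_le (s * m.im - r)
    linarith
  rw [le_div_iff₀ hr0, ← hw]
  have e : m ^ 2 - L ^ 2 = (m - L) * (m + L) := by ring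
  rw [e, norm_mul]
  exact mul_le_mul_of_nonneg_left hlow (norm_nonneg _)
end

section
/- Fix real constants c > 0 and v > 0. For every τ ∈ ℂ with Re τ > 0 and every η ∈ ℝ, one has Re μ⁺(τ,η) ≥ (Re τ)/(√2 · c) and Re μ⁻(τ,η) ≥ (Re τ)/(√2 · c). -/
theorem aux_re (m z : ℂ) (η : ℝ) (hm : 0 < m.re) (hz : 0 < z.re)
    (h : m ^ 2 = z ^ 2 + (η : ℂ) ^ 2) : z.re ≤ m.re := by
  have h1 := congrArg Complex.re h
  have h2 := congrArg Complex.im h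
  simp [pow_two] at h1 h2
  have h3 : m.re * m.im = z.re * z.im := by linarith
  have h4 : (m.re ^ 2 - z.re ^ 2) * (m.re ^ 2 + z.im ^ 2) = m.re ^ 2 * η ^ 2 := by
    linear_combination m.re ^ 2 * h1 + (m.re * m.im + z.re * z.im) * h3
  by_contra hlt
  push Not at hlt
  have h5 : 0 < z.re ^ 2 - m.re ^ 2 := by nlinarith
  have h6 : 0 < m.re ^ 2 + z.im ^ 2 := by positivity
  have h7 : 0 ≤ m.re ^ 2 * η ^ 2 := by positivity
  nlinarith [mul_pos h5 h6]

/-- Re μ⁺(τ,η) ≥ (Re τ)/(√2 c) and Re μ⁻(τ,η) ≥ (Re τ)/(√2 c) whenever Re τ > 0. -/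
theorem stmt_3 (c v : ℝ) (hc : 0 < c) (hv : 0 < v)
    (μp μm : ℂ → ℝ → ℂ)
    (hμp : ∀ (τ : ℂ) (η : ℝ), 0 < τ.re →
      0 < (μp τ η).re ∧
        (μp τ η) ^ 2 = ((τ + Complex.I * (v : ℂ) * (η : ℂ)) / (c : ℂ)) ^ 2 + (η : ℂ) ^ 2)
    (hμm : ∀ (τ : ℂ) (η : ℝ), 0 < τ.re →
      0 < (μm τ η).re ∧
        (μm τ η) ^ 2 = ((τ - Complex.I * (v : ℂ) * (η : ℂ)) / (c : ℂ)) ^ 2 + (η : ℂ) ^ 2) :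
    ∀ (τ : ℂ) (η : ℝ), 0 < τ.re →
      τ.re / (Real.sqrt 2 * c) ≤ (μp τ η).re ∧ τ.re / (Real.sqrt 2 * c) ≤ (μm τ η).re := by
  intro τ η hτ
  have hs : (1 : ℝ) ≤ Real.sqrt 2 := Real.one_le_sqrt.mpr (by norm_num)
  have hle : τ.re / (Real.sqrt 2 * c) ≤ τ.re / c := by
    apply div_le_div_of_nonneg_left hτ.le hc
    nlinarith
  have hpos : 0 < τ.re / c := div_pos hτ hc
  obtain ⟨p1, p2⟩ := hμp τ η hτ
  obtain ⟨m1, m2⟩ := hμm τ η hτ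
  have ep : ((τ + Complex.I * (v : ℂ) * (η : ℂ)) / (c : ℂ)).re = τ.re / c := by
    simp [Complex.div_ofReal_re]
  have em : ((τ - Complex.I * (v : ℂ) * (η : ℂ)) / (c : ℂ)).re = τ.re / c := by
    simp [Complex.div_ofReal_re]
  have rp := aux_re _ _ η p1 (by rw [ep]; exact hpos) p2
  have rm := aux_re _ _ η m1 (by rw [em]; exact hpos) m2
  rw [ep] at rp
  rw [em] at rm
  exact ⟨hle.trans rp, hle.trans rm⟩
end

section
/- Fix real constants c > 0 and v > 0. For every τ ∈ ℂ with Re τ > 0 and every η ∈ ℝ, the front symbol satisfies the identity Σ(τ,η) = c² (μ⁺(τ,η) μ⁻(τ,η) − η²). -/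
/-- For Re τ > 0, the front symbol satisfies Σ(τ,η) = c²(μ⁺μ⁻ − η²), where
Σ(τ,η) = τ² + v²η²(8τ²/(c²(μ⁺+μ⁻)²) − 1). -/
theorem stmt_6 (c v : ℝ) (hc : 0 < c) (hv : 0 < v)
    (μp μm : ℂ → ℝ → ℂ)
    (hμp : ∀ (τ : ℂ) (η : ℝ), 0 < τ.re →
      0 < (μp τ η).re ∧
        (μp τ η) ^ 2 = ((τ + Complex.I * (v : ℂ) * (η : ℂ)) / (c : ℂ)) ^ 2 + (η : ℂ) ^ 2)
    (hμm : ∀ (τ : ℂ) (η : ℝ), 0 < τ.re →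
      0 < (μm τ η).re ∧
        (μm τ η) ^ 2 = ((τ - Complex.I * (v : ℂ) * (η : ℂ)) / (c : ℂ)) ^ 2 + (η : ℂ) ^ 2) :
    ∀ (τ : ℂ) (η : ℝ), 0 < τ.re →
      τ ^ 2 + (v : ℂ) ^ 2 * (η : ℂ) ^ 2 *
          (8 * τ ^ 2 / ((c : ℂ) ^ 2 * (μp τ η + μm τ η) ^ 2) - 1)
        = (c : ℂ) ^ 2 * (μp τ η * μm τ η - (η : ℂ) ^ 2) := by
  intro τ η hτ
  obtain ⟨hp, ep⟩ := hμp τ η hτ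
  obtain ⟨hm, em⟩ := hμm τ η hτ
  generalize μp τ η = p at *
  generalize μm τ η = m at *
  have hs : p + m ≠ 0 := by
    intro h
    have := congrArg Complex.re h
    simp at this
    linarith
  have hc0 : (c : ℂ) ≠ 0 := by exact_mod_cast hc.ne'
  have ep2 : (c : ℂ) ^ 2 * p ^ 2 = (τ + Complex.I * v * η) ^ 2 + (c : ℂ) ^ 2 * η ^ 2 := by
    rw [ep]; field_simp
  have em2 : (c : ℂ) ^ 2 * m ^ 2 = (τ - Complex.I * v * η) ^ 2 + (c : ℂ) ^ 2 * η ^ 2 := by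
    rw [em]; field_simp
  have hI := Complex.I_sq
  have hd : (c : ℂ) ^ 2 * (p ^ 2 - m ^ 2) = 4 * Complex.I * τ * v * η := by
    linear_combination ep2 - em2
  have hsq : ((c : ℂ) ^ 2 * (p ^ 2 - m ^ 2)) ^ 2 = -16 * τ ^ 2 * v ^ 2 * η ^ 2 := by
    rw [hd]
    linear_combination 16 * τ ^ 2 * v ^ 2 * η ^ 2 * hI
  have hq : (v : ℂ) ^ 2 * η ^ 2 * (8 * τ ^ 2 / ((c : ℂ) ^ 2 * (p + m) ^ 2))
      = -(c : ℂ) ^ 2 * (p - m) ^ 2 / 2 := by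
    rw [← mul_div_assoc, div_eq_div_iff (by positivity) (by norm_num)]
    linear_combination hsq
  linear_combination hq - ep2 / 2 - em2 / 2 - v ^ 2 * η ^ 2 * hI
end

section
/- Fix real constants c > 0 and v > 0 with v/c > √2. Then for every τ ∈ ℂ with Re τ > 0 and every η ∈ ℝ, the front symbol satisfies Σ(τ,η) ≠ 0. -/
/-- For v/c > √2, the front symbol Σ(τ,η) is nonzero for every τ with
Re τ > 0 and every η ∈ ℝ. -/
theorem stmt_11 (c v : ℝ) (hc : 0 < c) (hv : 0 < v) (hvc : Real.sqrt 2 < v / c)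
    (μp μm : ℂ → ℝ → ℂ)
    (hμp : ∀ (τ : ℂ) (η : ℝ), 0 < τ.re →
      0 < (μp τ η).re ∧
        (μp τ η) ^ 2 = ((τ + Complex.I * (v : ℂ) * (η : ℂ)) / (c : ℂ)) ^ 2 + (η : ℂ) ^ 2)
    (hμm : ∀ (τ : ℂ) (η : ℝ), 0 < τ.re →
      0 < (μm τ η).re ∧
        (μm τ η) ^ 2 = ((τ - Complex.I * (v : ℂ) * (η : ℂ)) / (c : ℂ)) ^ 2 + (η : ℂ) ^ 2) :
    ∀ (τ : ℂ) (η : ℝ), 0 < τ.re →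
      τ ^ 2 + (v : ℂ) ^ 2 * (η : ℂ) ^ 2 *
        (8 * τ ^ 2 / ((c : ℂ) ^ 2 * (μp τ η + μm τ η) ^ 2) - 1) ≠ 0 := by
  intro τ η hτ h
  obtain ⟨ha0, ha⟩ := hμp τ η hτ
  obtain ⟨hb0, hb⟩ := hμm τ η hτ
  generalize μp τ η = a at *
  generalize μm τ η = b at *
  have hs : a + b ≠ 0 := by
    intro h0
    have := congrArg Complex.re h0
    simp at this
    linarith
  have hcC : (c : ℂ) ≠ 0 := by exact_mod_cast hc.ne'
  have hI : Complex.I ^ 2 = -1 := Complex.I_sq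
  have hM : 2 * c ^ 2 < v ^ 2 := by
    rw [lt_div_iff₀ hc] at hvc
    have h2 : Real.sqrt 2 ^ 2 = 2 := Real.sq_sqrt (by norm_num)
    have h3 : 0 ≤ Real.sqrt 2 * c := by positivity
    calc 2 * c ^ 2 = (Real.sqrt 2 * c) ^ 2 := by rw [mul_pow, h2]
      _ < v ^ 2 := by gcongr
  have ha' : (c : ℂ) ^ 2 * a ^ 2 = (τ + Complex.I * v * η) ^ 2 + c ^ 2 * η ^ 2 := by
    rw [ha]; field_simp
  have hb' : (c : ℂ) ^ 2 * b ^ 2 = (τ - Complex.I * v * η) ^ 2 + c ^ 2 * η ^ 2 := by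
    rw [hb]; field_simp
  have hd : (c : ℂ) ^ 2 * ((a - b) * (a + b)) = 4 * Complex.I * v * η * τ := by
    linear_combination ha' - hb'
  have hfrac : (v : ℂ) ^ 2 * η ^ 2 * (8 * τ ^ 2 / ((c : ℂ) ^ 2 * (a + b) ^ 2))
      = - (c : ℂ) ^ 2 * (a - b) ^ 2 / 2 := by
    field_simp
    have := congrArg (fun z => z ^ 2) hd
    linear_combination this + 16 * v ^ 2 * η ^ 2 * τ ^ 2 * hI
  have hab : (c : ℂ) ^ 2 * (a * b) = c ^ 2 * η ^ 2 := by
    linear_combination h - hfrac + (ha' + hb') / 2 + v ^ 2 * η ^ 2 * hI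
  have hq : (τ ^ 2 + η ^ 2 * (v ^ 2 + c ^ 2)) ^ 2 = (η : ℂ) ^ 4 * c ^ 2 * (4 * v ^ 2 + c ^ 2) := by
    have h1 : ((τ + Complex.I * v * η) ^ 2 + (c : ℂ) ^ 2 * η ^ 2) *
        ((τ - Complex.I * v * η) ^ 2 + c ^ 2 * η ^ 2) = (c ^ 2 * η ^ 2) ^ 2 := by
      rw [← ha', ← hb', ← hab]; ring
    have h2 : (τ + Complex.I * v * η) ^ 2 = τ ^ 2 + 2 * Complex.I * v * η * τ - v ^ 2 * η ^ 2 := by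
      linear_combination v ^ 2 * η ^ 2 * hI
    have h3 : (τ - Complex.I * v * η) ^ 2 = τ ^ 2 - 2 * Complex.I * v * η * τ - v ^ 2 * η ^ 2 := by
      linear_combination v ^ 2 * η ^ 2 * hI
    rw [h2, h3] at h1
    linear_combination h1 + 4 * v ^ 2 * η ^ 2 * τ ^ 2 * hI
  obtain ⟨x, y⟩ := τ
  simp only at hτ
  have hre := congrArg Complex.re hq
  have him := congrArg Complex.im hq
  have e : (Complex.mk x y) ^ 2 + (η : ℂ) ^ 2 * (v ^ 2 + c ^ 2)
      = Complex.mk (x ^ 2 - y ^ 2 + η ^ 2 * (v ^ 2 + c ^ 2)) (2 * x * y) := by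
    apply Complex.ext
    · simp [pow_two]
    · simp [pow_two]; ring
  have e2 : (η : ℂ) ^ 4 * c ^ 2 * (4 * v ^ 2 + c ^ 2)
      = ((η ^ 4 * c ^ 2 * (4 * v ^ 2 + c ^ 2) : ℝ) : ℂ) := by push_cast; ring
  rw [e, e2, Complex.ofReal_re, pow_two, Complex.mul_re] at hre
  rw [e, e2, Complex.ofReal_im, pow_two, Complex.mul_im] at him
  simp only at hre him
  have hD : 0 ≤ η ^ 4 * c ^ 2 * (4 * v ^ 2 + c ^ 2) := by positivity
  have hy : y = 0 := by
    by_contra hy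
    have h4 : (x * y) * (x ^ 2 - y ^ 2 + η ^ 2 * (v ^ 2 + c ^ 2)) = 0 := by linarith
    have hxy : x * y ≠ 0 := mul_ne_zero hτ.ne' hy
    have h5 := (mul_eq_zero.mp h4).resolve_left hxy
    rw [h5] at hre
    have : 0 < (x * y) ^ 2 := by positivity
    linarith
  subst hy
  have p1 : 0 < x ^ 4 := by positivity
  have p2 : 0 ≤ x ^ 2 * η ^ 2 * (v ^ 2 + c ^ 2) := by positivity
  have p3 : 0 ≤ η ^ 4 * v ^ 2 * (v ^ 2 - 2 * c ^ 2) :=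
    mul_nonneg (by positivity) (by linarith)
  linarith
end

section
/- Fix real constants c > 0 and v > 0 with v/c < √2, and set Y₁ := √(√(4(v/c)² + 1) − (v/c)² − 1). Then for every τ ∈ ℂ with Re τ > 0 and every η ∈ ℝ, the front symbol satisfies Σ(τ,η) = 0 if and only if η ≠ 0 and τ = c Y₁ |η|. -/
lemma sq_unique_aux {a b : ℂ} (ha : 0 < a.re) (hb : 0 < b.re) (h : a ^ 2 = b ^ 2) : a = b := by
  rcases sq_eq_sq_iff_eq_or_eq_neg.mp h with h | h
  · exact h
  · exfalso
    rw [h, Complex.neg_re] at ha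
    linarith

/-- The front symbol in normalised form is `A * B - e ^ 2`. -/
lemma symbol_aux {A B t e w : ℂ} (hS : A + B ≠ 0)
    (hA : A ^ 2 = (t + Complex.I * w * e) ^ 2 + e ^ 2)
    (hB : B ^ 2 = (t - Complex.I * w * e) ^ 2 + e ^ 2) :
    t ^ 2 + w ^ 2 * e ^ 2 * (8 * t ^ 2 / (A + B) ^ 2 - 1) = A * B - e ^ 2 := by
  have hI : Complex.I ^ 2 = -1 := Complex.I_sq
  have hd : A ^ 2 - B ^ 2 = 4 * Complex.I * w * e * t := by rw [hA, hB]; ring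
  have hs : A ^ 2 + B ^ 2 = 2 * (t ^ 2 - w ^ 2 * e ^ 2 + e ^ 2) := by
    rw [hA, hB]; linear_combination (2 * w ^ 2 * e ^ 2) * hI
  have hq : (A ^ 2 - B ^ 2) ^ 2 = -16 * w ^ 2 * e ^ 2 * t ^ 2 := by
    rw [hd]; linear_combination (16 * w ^ 2 * e ^ 2 * t ^ 2) * hI
  have h8 : w ^ 2 * e ^ 2 * (8 * t ^ 2) / (A + B) ^ 2 = -(A - B) ^ 2 / 2 := by
    rw [div_eq_iff (pow_ne_zero 2 hS)]
    linear_combination (1 / 2) * hq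
  have : w ^ 2 * e ^ 2 * (8 * t ^ 2 / (A + B) ^ 2 - 1)
      = w ^ 2 * e ^ 2 * (8 * t ^ 2) / (A + B) ^ 2 - w ^ 2 * e ^ 2 := by ring
  rw [this, h8]
  linear_combination (-1 / 2) * hs

/-- For v/c < √2 and Y₁ = √(√(4(v/c)²+1) − (v/c)² − 1), the front symbol
vanishes at (τ,η) with Re τ > 0 iff η ≠ 0 and τ = cY₁|η|. -/
theorem stmt_12 (c v : ℝ) (hc : 0 < c) (hv : 0 < v) (hvc : v / c < Real.sqrt 2)
    (Y1 : ℝ) (hY1 : Y1 = Real.sqrt (Real.sqrt (4 * (v / c) ^ 2 + 1) - (v / c) ^ 2 - 1))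
    (μp μm : ℂ → ℝ → ℂ)
    (hμp : ∀ (τ : ℂ) (η : ℝ), 0 < τ.re →
      0 < (μp τ η).re ∧
        (μp τ η) ^ 2 = ((τ + Complex.I * (v : ℂ) * (η : ℂ)) / (c : ℂ)) ^ 2 + (η : ℂ) ^ 2)
    (hμm : ∀ (τ : ℂ) (η : ℝ), 0 < τ.re →
      0 < (μm τ η).re ∧
        (μm τ η) ^ 2 = ((τ - Complex.I * (v : ℂ) * (η : ℂ)) / (c : ℂ)) ^ 2 + (η : ℂ) ^ 2) :
    ∀ (τ : ℂ) (η : ℝ), 0 < τ.re →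
      (τ ^ 2 + (v : ℂ) ^ 2 * (η : ℂ) ^ 2 *
          (8 * τ ^ 2 / ((c : ℂ) ^ 2 * (μp τ η + μm τ η) ^ 2) - 1) = 0
        ↔ η ≠ 0 ∧ τ = ((c * Y1 * |η| : ℝ) : ℂ)) := by
  intro τ η hτ
  obtain ⟨hA0, hA⟩ := hμp τ η hτ
  obtain ⟨hB0, hB⟩ := hμm τ η hτ
  generalize μp τ η = A at *
  generalize μm τ η = B at *
  have hcC : (c : ℂ) ≠ 0 := by exact_mod_cast hc.ne'
  obtain ⟨w, hw⟩ : ∃ w, w = v / c := ⟨_, rfl⟩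
  obtain ⟨t, ht⟩ : ∃ t : ℂ, t = τ / c := ⟨_, rfl⟩
  have hvw : v = c * w := by rw [hw]; field_simp
  have hτt : τ = c * t := by rw [ht]; field_simp
  have hw0 : 0 < w := by rw [hw]; positivity
  rw [← hw] at hvc hY1
  have hw2 : w ^ 2 < 2 := by
    have := Real.sq_sqrt (show (0 : ℝ) ≤ 2 by norm_num)
    nlinarith [Real.sqrt_nonneg 2]
  have htre : 0 < t.re := by
    rw [hτt, Complex.re_ofReal_mul] at hτ
    exact (mul_pos_iff_of_pos_left hc).mp hτ
  have hA' : A ^ 2 = (t + Complex.I * w * η) ^ 2 + (η : ℂ) ^ 2 := by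
    rw [hA, hτt, hvw]; push_cast; field_simp
  have hB' : B ^ 2 = (t - Complex.I * w * η) ^ 2 + (η : ℂ) ^ 2 := by
    rw [hB, hτt, hvw]; push_cast; field_simp
  have hS : A + B ≠ 0 := by
    intro h
    have := congrArg Complex.re h
    simp at this
    linarith
  have hsym := symbol_aux hS hA' hB'
  have hSym : τ ^ 2 + (v : ℂ) ^ 2 * (η : ℂ) ^ 2 *
          (8 * τ ^ 2 / ((c : ℂ) ^ 2 * (A + B) ^ 2) - 1) = (c : ℂ) ^ 2 * (A * B - (η : ℂ) ^ 2) := by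
    rw [← hsym, hτt, hvw]; push_cast; field_simp
  rw [hSym]
  obtain ⟨R, hR⟩ : ∃ R, R = Real.sqrt (4 * w ^ 2 + 1) := ⟨_, rfl⟩
  rw [← hR] at hY1
  have hR0 : 0 ≤ R := by rw [hR]; positivity
  have hR2 : R ^ 2 = 4 * w ^ 2 + 1 := by rw [hR]; exact Real.sq_sqrt (by positivity)
  have hRw : w ^ 2 + 1 < R := by
    have : 0 < w ^ 2 := by positivity
    nlinarith
  have hY0 : 0 < Y1 := by rw [hY1]; exact Real.sqrt_pos.mpr (by linarith)
  have hY2 : Y1 ^ 2 = R - w ^ 2 - 1 := by rw [hY1]; exact Real.sq_sqrt (by linarith)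
  have hR2C : (R : ℂ) ^ 2 = 4 * w ^ 2 + 1 := by exact_mod_cast hR2
  have hY2C : (Y1 : ℂ) ^ 2 = R - w ^ 2 - 1 := by exact_mod_cast hY2
  have hfac : (A * B) ^ 2 - (η : ℂ) ^ 4
      = (t ^ 2 - (Y1 * η) ^ 2) * (t ^ 2 + (R + w ^ 2 + 1) * η ^ 2) := by
    have h1 : (A * B) ^ 2 = (t ^ 2 + w ^ 2 * η ^ 2) ^ 2 + 2 * η ^ 2 * (t ^ 2 - w ^ 2 * η ^ 2)
        + (η : ℂ) ^ 4 := by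
      have e1 : (t + Complex.I * w * η) * (t - Complex.I * w * η) = t ^ 2 + w ^ 2 * η ^ 2 := by
        linear_combination (-(w : ℂ) ^ 2 * η ^ 2) * Complex.I_sq
      have e2 : (t + Complex.I * w * η) ^ 2 + (t - Complex.I * w * η) ^ 2
          = 2 * (t ^ 2 - w ^ 2 * η ^ 2) := by
        linear_combination (2 * (w : ℂ) ^ 2 * η ^ 2) * Complex.I_sq
      rw [mul_pow, hA', hB', ← e1]
      linear_combination ((η : ℂ) ^ 2) * e2
    rw [h1, mul_pow, hY2C]
    linear_combination ((η : ℂ) ^ 4) * hR2C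
  constructor
  · intro h
    have hAB : A * B = (η : ℂ) ^ 2 := by
      rcases mul_eq_zero.mp h with h | h
      · exact absurd h (pow_ne_zero 2 hcC)
      · exact sub_eq_zero.mp h
    have hη : η ≠ 0 := by
      rintro rfl
      have hA1 : A ≠ 0 := by rintro rfl; simp at hA0
      have hB1 : B ≠ 0 := by rintro rfl; simp at hB0
      simp [hA1, hB1] at hAB
    refine ⟨hη, ?_⟩
    have h0 : (t ^ 2 - ((Y1 : ℂ) * η) ^ 2) * (t ^ 2 + (R + w ^ 2 + 1) * η ^ 2) = 0 := by
      rw [← hfac, hAB]; ring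
    have hab : 0 < |η| := abs_pos.mpr hη
    rcases mul_eq_zero.mp h0 with h1 | h1
    · have h2 : t ^ 2 = ((Y1 * |η| : ℝ) : ℂ) ^ 2 := by
        have : ((|η| : ℝ) : ℂ) ^ 2 = (η : ℂ) ^ 2 := by exact_mod_cast sq_abs η
        push_cast
        rw [mul_pow, this]
        linear_combination h1
      have h3 := sq_unique_aux htre (by rw [Complex.ofReal_re]; positivity) h2
      rw [hτt, h3]; push_cast; ring
    · exfalso
      have hre := congrArg Complex.re h1
      have him := congrArg Complex.im h1
      have e : ((R : ℂ) + w ^ 2 + 1) * η ^ 2 = (((R + w ^ 2 + 1) * η ^ 2 : ℝ) : ℂ) := by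
        push_cast; ring
      rw [e] at hre him
      simp only [Complex.add_re, Complex.add_im, Complex.ofReal_re, Complex.ofReal_im, pow_two t,
        Complex.mul_re, Complex.mul_im, Complex.zero_re, Complex.zero_im] at hre him
      have hi : t.im = 0 := by
        have : t.re * t.im = 0 := by linarith
        exact (mul_eq_zero.mp this).resolve_left htre.ne'
      rw [hi] at hre
      have : 0 < (R + w ^ 2 + 1) * η ^ 2 := by positivity
      nlinarith
  · rintro ⟨hη, hτ'⟩
    have hab : 0 < |η| := abs_pos.mpr hη
    have htr : t = ((Y1 * |η| : ℝ) : ℂ) := by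
      rw [ht, hτ']; push_cast; field_simp
    have hBA : B = (starRingEnd ℂ) A := by
      apply sq_unique_aux hB0 (by simpa using hA0)
      rw [← map_pow, hA', hB', htr]
      simp
      ring
    have h2 : A * B = ((Complex.normSq A : ℝ) : ℂ) := by rw [hBA, Complex.mul_conj]
    have h3 : (A * B) ^ 2 = ((η : ℂ) ^ 2) ^ 2 := by
      have : ((|η| : ℝ) : ℂ) ^ 2 = (η : ℂ) ^ 2 := by exact_mod_cast sq_abs η
      have h4 : t ^ 2 - ((Y1 : ℂ) * η) ^ 2 = 0 := by
        rw [htr]; push_cast; rw [mul_pow, this]; ring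
      rw [h4, zero_mul] at hfac
      linear_combination hfac
    have hA1 : A ≠ 0 := by rintro rfl; simp at hA0
    have h5 : A * B = (η : ℂ) ^ 2 := by
      apply sq_unique_aux _ _ h3
      · rw [h2, Complex.ofReal_re]; exact Complex.normSq_pos.mpr hA1
      · rw [← Complex.ofReal_pow, Complex.ofReal_re]; positivity
    rw [h5]; ring
end

section
/- Fix real constants c > 0 and v > 0 with v ≥ c, and fix η̄ ∈ ℝ with η̄ ≠ 0. Then the function (τ,η) ↦ (τ/c)² / (μ⁺(τ,η) + μ⁻(τ,η))², defined for Re τ > 0 and η ∈ ℝ, converges to the real number ((v/c)² − 1)/(4 (v/c)²) as (τ,η) → (0, η̄) with (τ,η) ranging over {τ ∈ ℂ : Re τ > 0} × ℝ. -/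
lemma aux_sq (z : ℂ) (r : ℝ) (hz : 0 ≤ z.re) (hr : 0 ≤ r) :
    ‖z - r‖ ^ 2 ≤ ‖z ^ 2 - (r : ℂ) ^ 2‖ := by
  have h1 : z ^ 2 - (r : ℂ) ^ 2 = (z - r) * (z + r) := by ring
  have h2 : ‖z - r‖ ≤ ‖z + r‖ := by
    rw [Complex.norm_def, Complex.norm_def]
    apply Real.sqrt_le_sqrt
    simp only [Complex.normSq_apply, Complex.sub_re, Complex.add_re, Complex.sub_im,
      Complex.add_im, Complex.ofReal_re, Complex.ofReal_im]
    nlinarith [mul_nonneg hz hr]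
  rw [h1, norm_mul, sq]
  gcongr

lemma aux_re_s16 (a b τ : ℂ) (c v η : ℝ) (hc : 0 < c) (hτ : 0 < τ.re) (ha : 0 < a.re) (hb : 0 < b.re)
    (hs : (τ.im + v * η) * (τ.im - v * η) < 0)
    (h1 : a ^ 2 = ((τ + Complex.I * (v : ℂ) * (η : ℂ)) / (c : ℂ)) ^ 2 + (η : ℂ) ^ 2)
    (h2 : b ^ 2 = ((τ - Complex.I * (v : ℂ) * (η : ℂ)) / (c : ℂ)) ^ 2 + (η : ℂ) ^ 2) :
    0 ≤ (a * b).re := by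
  have hc' : (c : ℂ) ≠ 0 := by exact_mod_cast hc.ne'
  have e1 : (c : ℂ) ^ 2 * a ^ 2 = (τ + Complex.I * v * η) ^ 2 + c ^ 2 * η ^ 2 := by
    rw [h1]; field_simp
  have e2 : (c : ℂ) ^ 2 * b ^ 2 = (τ - Complex.I * v * η) ^ 2 + c ^ 2 * η ^ 2 := by
    rw [h2]; field_simp
  have i1 := congrArg Complex.im e1
  have i2 := congrArg Complex.im e2
  simp [sq] at i1 i2
  have j1 : c ^ 2 * (a.re * a.im) = τ.re * (τ.im + v * η) := by linarith
  have j2 : c ^ 2 * (b.re * b.im) = τ.re * (τ.im - v * η) := by linarith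
  have k : (c ^ 4 * (a.re * b.re)) * (a.im * b.im)
      = τ.re ^ 2 * ((τ.im + v * η) * (τ.im - v * η)) := by
    linear_combination (c ^ 2 * (b.re * b.im)) * j1 + τ.re * (τ.im + v * η) * j2
  have k2 : a.im * b.im ≤ 0 := by
    by_contra hcon
    push Not at hcon
    have : 0 < (c ^ 4 * (a.re * b.re)) * (a.im * b.im) := by positivity
    have : τ.re ^ 2 * ((τ.im + v * η) * (τ.im - v * η)) < 0 :=
      mul_neg_of_pos_of_neg (by positivity) hs
    linarith
  rw [Complex.mul_re]
  have := mul_pos ha hb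
  linarith

/-- For v ≥ c and η̄ ≠ 0, the function (τ,η) ↦ (τ/c)²/(μ⁺+μ⁻)² tends to
((v/c)²−1)/(4(v/c)²) as (τ,η) → (0,η̄) with Re τ > 0. -/
theorem stmt_16 (c v : ℝ) (hc : 0 < c) (hv : 0 < v) (hvc : c ≤ v)
    (ηb : ℝ) (hηb : ηb ≠ 0)
    (μp μm : ℂ → ℝ → ℂ)
    (hμp : ∀ (τ : ℂ) (η : ℝ), 0 < τ.re →
      0 < (μp τ η).re ∧
        (μp τ η) ^ 2 = ((τ + Complex.I * (v : ℂ) * (η : ℂ)) / (c : ℂ)) ^ 2 + (η : ℂ) ^ 2)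
    (hμm : ∀ (τ : ℂ) (η : ℝ), 0 < τ.re →
      0 < (μm τ η).re ∧
        (μm τ η) ^ 2 = ((τ - Complex.I * (v : ℂ) * (η : ℂ)) / (c : ℂ)) ^ 2 + (η : ℂ) ^ 2) :
    Filter.Tendsto
      (fun p : ℂ × ℝ => (p.1 / (c : ℂ)) ^ 2 / (μp p.1 p.2 + μm p.1 p.2) ^ 2)
      (nhdsWithin ((0 : ℂ), ηb) {p : ℂ × ℝ | 0 < p.1.re})
      (nhds ((((v / c) ^ 2 - 1) / (4 * (v / c) ^ 2) : ℝ) : ℂ)) := by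
  have hc' : (c : ℂ) ≠ 0 := by exact_mod_cast hc.ne'
  have hv' : (v : ℂ) ≠ 0 := by exact_mod_cast hv.ne'
  have hη' : (ηb : ℂ) ≠ 0 := by exact_mod_cast hηb
  set l := nhdsWithin ((0 : ℂ), ηb) {p : ℂ × ℝ | 0 < p.1.re} with hl
  have hle : l ≤ nhds ((0 : ℂ), ηb) := nhdsWithin_le_nhds
  have hpos : ∀ᶠ p in l, 0 < p.1.re := self_mem_nhdsWithin
  set P : ℂ × ℝ → ℂ := fun p =>
    ((p.1 + Complex.I * (v : ℂ) * (p.2 : ℂ)) / (c : ℂ)) ^ 2 + (p.2 : ℂ) ^ 2 with hP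
  set M : ℂ × ℝ → ℂ := fun p =>
    ((p.1 - Complex.I * (v : ℂ) * (p.2 : ℂ)) / (c : ℂ)) ^ 2 + (p.2 : ℂ) ^ 2 with hM
  have cP : Continuous P := by fun_prop
  have cM : Continuous M := by fun_prop
  set r : ℝ := ηb ^ 2 * ((v / c) ^ 2 - 1) with hr
  have hr0 : 0 ≤ r := by
    have : 1 ≤ v / c := by rw [le_div_iff₀ hc]; linarith
    have : 0 ≤ (v / c) ^ 2 - 1 := by nlinarith
    positivity
  have P0 : P ((0 : ℂ), ηb) = -(r : ℂ) := by
    simp only [hP, hr]; push_cast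
    field_simp
    linear_combination (v : ℂ) ^ 2 * (ηb : ℂ) ^ 2 * Complex.I_sq
  have M0 : M ((0 : ℂ), ηb) = -(r : ℂ) := by
    simp only [hM, hr]; push_cast
    field_simp
    linear_combination (v : ℂ) ^ 2 * (ηb : ℂ) ^ 2 * Complex.I_sq
  have tP : Filter.Tendsto P l (nhds (-(r : ℂ))) := P0 ▸ (cP.tendsto _).mono_left hle
  have tM : Filter.Tendsto M l (nhds (-(r : ℂ))) := M0 ▸ (cM.tendsto _).mono_left hle
  have hsgn : ∀ᶠ p in l, (p.1.im + v * p.2) * (p.1.im - v * p.2) < 0 := by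
    have hcont : Continuous fun p : ℂ × ℝ => (p.1.im + v * p.2) * (p.1.im - v * p.2) := by
      fun_prop
    refine hle (hcont.continuousAt.eventually_lt continuousAt_const ?_)
    have : 0 < (v * ηb) ^ 2 := by positivity
    simp only [Complex.zero_im]
    nlinarith
  have hne : ∀ᶠ p in l, p.2 ≠ 0 :=
    hle ((continuous_snd.continuousAt (x := ((0 : ℂ), ηb))).eventually_ne hηb)
  set w : ℂ × ℝ → ℂ := fun p => μp p.1 p.2 * μm p.1 p.2 with hw
  have tw : Filter.Tendsto w l (nhds (r : ℂ)) := by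
    rw [tendsto_iff_norm_sub_tendsto_zero]
    have t1 : Filter.Tendsto (fun p => Real.sqrt ‖P p * M p - (r : ℂ) ^ 2‖) l (nhds 0) := by
      have := (((tP.mul tM).sub_const ((r : ℂ) ^ 2)).norm).sqrt
      have e : -(r : ℂ) * -(r : ℂ) - (r : ℂ) ^ 2 = 0 := by ring
      rwa [e, norm_zero, Real.sqrt_zero] at this
    refine squeeze_zero' (Filter.Eventually.of_forall fun _ => norm_nonneg _) ?_ t1
    filter_upwards [hpos, hsgn] with p hp hs
    obtain ⟨a1, a2⟩ := hμp p.1 p.2 hp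
    obtain ⟨b1, b2⟩ := hμm p.1 p.2 hp
    apply Real.le_sqrt_of_sq_le
    have h := aux_sq (w p) r (aux_re_s16 _ _ p.1 c v p.2 hc hp a1 b1 hs a2 b2) hr0
    have e : w p ^ 2 = P p * M p := by simp only [hw, hP, hM, mul_pow, a2, b2]
    rwa [e] at h
  have tη : Filter.Tendsto (fun p : ℂ × ℝ => (p.2 : ℂ)) l (nhds (ηb : ℂ)) := by
    have : Continuous fun p : ℂ × ℝ => (p.2 : ℂ) := by fun_prop
    exact (this.tendsto ((0 : ℂ), ηb)).mono_left hle
  have main : Filter.Tendsto (fun p : ℂ × ℝ =>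
      -((c : ℂ) ^ 2 * (P p + M p - 2 * w p)) / (16 * (v : ℂ) ^ 2 * (p.2 : ℂ) ^ 2)) l
      (nhds (-((c : ℂ) ^ 2 * (-(r : ℂ) + -(r : ℂ) - 2 * r)) / (16 * (v : ℂ) ^ 2 * (ηb : ℂ) ^ 2))) :=
    ((((tP.add tM).sub (tw.const_mul 2)).const_mul _).neg).div ((tη.pow 2).const_mul _)
      (by simp [hv', hη'])
  have e : -((c : ℂ) ^ 2 * (-(r : ℂ) + -(r : ℂ) - 2 * r)) / (16 * (v : ℂ) ^ 2 * (ηb : ℂ) ^ 2)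
      = ((((v / c) ^ 2 - 1) / (4 * (v / c) ^ 2) : ℝ) : ℂ) := by
    simp only [hr]; push_cast
    field_simp
    ring
  rw [e] at main
  refine main.congr' ?_
  filter_upwards [hpos, hne] with p hp hn
  obtain ⟨a1, a2⟩ := hμp p.1 p.2 hp
  obtain ⟨b1, b2⟩ := hμm p.1 p.2 hp
  have hn' : (p.2 : ℂ) ≠ 0 := by exact_mod_cast hn
  have hsum : μp p.1 p.2 + μm p.1 p.2 ≠ 0 := by
    intro h
    have := congrArg Complex.re h
    simp at this
    linarith
  have d1 : P p + M p - 2 * w p = (μp p.1 p.2 - μm p.1 p.2) ^ 2 := by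
    simp only [hP, hM, hw, ← a2, ← b2]; ring
  have d2 : (c : ℂ) ^ 2 * ((μp p.1 p.2 - μm p.1 p.2) * (μp p.1 p.2 + μm p.1 p.2))
      = 4 * Complex.I * p.1 * v * p.2 := by
    have : (μp p.1 p.2 - μm p.1 p.2) * (μp p.1 p.2 + μm p.1 p.2)
      = μp p.1 p.2 ^ 2 - μm p.1 p.2 ^ 2 := by ring
    rw [this, a2, b2]
    field_simp
    ring
  rw [d1, div_pow, div_div, div_eq_div_iff (by simp [hv', hn']) (by simp [hc', hsum])]
  generalize μp p.1 p.2 = a at *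
  generalize μm p.1 p.2 = b at *
  linear_combination (-((c : ℂ) ^ 2 * ((a - b) * (a + b))) - 4 * Complex.I * p.1 * v * p.2) * d2
    - 16 * p.1 ^ 2 * (v : ℂ) ^ 2 * (p.2 : ℂ) ^ 2 * Complex.I_sq
end

section
/- Let f : ℝ² → ℝ be twice continuously differentiable (variables (t, x₁)) and u = (u₁, u₂) : ℝ³ → ℝ² be continuously differentiable (variables (t, x₁, x₂)). Define θ : ℝ² → ℝ by θ(t, x₁) := u₂(t, x₁, f(t, x₁)) − u₁(t, x₁, f(t, x₁)) ∂₁f(t, x₁), and define Z = (Z₁, Z₂) : ℝ³ → ℝ² by Zᵢ := ∂ₜuᵢ + u₁ ∂_{x₁}uᵢ + u₂ ∂_{x₂}uᵢ for i = 1, 2. Assume ∂ₜf(t, x₁) = θ(t, x₁) for all (t, x₁) ∈ ℝ². Then for every (t, x₁) ∈ ℝ², writing P := (t, x₁, f(t, x₁)): Z₂(P) − ∂₁f(t, x₁) Z₁(P) = ∂ₜθ(t, x₁) + 2 u₁(P) ∂₁θ(t, x₁) + u₁(P)² ∂₁∂₁f(t, x₁). -/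
/-- Partial derivative in the first variable of a function of two real variables. -/
noncomputable def pd_t (f : ℝ → ℝ → ℝ) (t x : ℝ) : ℝ := deriv (fun s => f s x) t

/-- Partial derivative in the second variable of a function of two real variables. -/
noncomputable def pd_x (f : ℝ → ℝ → ℝ) (t x : ℝ) : ℝ := deriv (fun y => f t y) x

/-- Partial derivative in the first variable (t) of a function of three real variables. -/
noncomputable def pd3_t (u : ℝ → ℝ → ℝ → ℝ) (t x y : ℝ) : ℝ := deriv (fun s => u s x y) t

/-- Partial derivative in the second variable (x₁) of a function of three real variables. -/
noncomputable def pd3_x (u : ℝ → ℝ → ℝ → ℝ) (t x y : ℝ) : ℝ := deriv (fun z => u t z y) x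

/-- Partial derivative in the third variable (x₂) of a function of three real variables. -/
noncomputable def pd3_y (u : ℝ → ℝ → ℝ → ℝ) (t x y : ℝ) : ℝ := deriv (fun z => u t x z) y

theorem aux_t {E : Type*} [NormedAddCommGroup E] [NormedSpace ℝ E] (g : ℝ × ℝ → E) (t x : ℝ)
    (hg : DifferentiableAt ℝ g (t, x)) :
    HasDerivAt (fun s => g (s, x)) (fderiv ℝ g (t, x) (1, 0)) t :=
  hg.hasFDerivAt.comp_hasDerivAt (f := fun s : ℝ => (s, x)) t
    ((hasDerivAt_id t).prodMk (hasDerivAt_const t x))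

theorem aux_x {E : Type*} [NormedAddCommGroup E] [NormedSpace ℝ E] (g : ℝ × ℝ → E) (t x : ℝ)
    (hg : DifferentiableAt ℝ g (t, x)) :
    HasDerivAt (fun s => g (t, s)) (fderiv ℝ g (t, x) (0, 1)) x :=
  hg.hasFDerivAt.comp_hasDerivAt (f := fun s : ℝ => (t, s)) x
    ((hasDerivAt_const x t).prodMk (hasDerivAt_id x))

/-- Chain rule along a curve, in terms of the three partial derivatives. -/
theorem aux_chain (u : ℝ → ℝ → ℝ → ℝ)
    (hu : Differentiable ℝ (fun p : ℝ × ℝ × ℝ => u p.1 p.2.1 p.2.2))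
    (a b c : ℝ → ℝ) (a' b' c' s : ℝ) (ha : HasDerivAt a a' s) (hb : HasDerivAt b b' s)
    (hc : HasDerivAt c c' s) :
    HasDerivAt (fun r => u (a r) (b r) (c r))
      (a' * pd3_t u (a s) (b s) (c s) + b' * pd3_x u (a s) (b s) (c s)
        + c' * pd3_y u (a s) (b s) (c s)) s := by
  have key : ∀ (a b c : ℝ → ℝ) (a' b' c' s : ℝ), HasDerivAt a a' s → HasDerivAt b b' s →
      HasDerivAt c c' s → HasDerivAt (fun r => u (a r) (b r) (c r))
        (fderiv ℝ (fun p : ℝ × ℝ × ℝ => u p.1 p.2.1 p.2.2) (a s, b s, c s) (a', b', c')) s := by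
    intro a b c a' b' c' s ha hb hc
    exact (hu (a s, b s, c s)).hasFDerivAt.comp_hasDerivAt (f := fun r : ℝ => (a r, b r, c r)) s
      (ha.prodMk (hb.prodMk hc))
  have h1 : pd3_t u (a s) (b s) (c s) = _ :=
    (key (fun r => r) (fun _ => b s) (fun _ => c s) 1 0 0 (a s) (hasDerivAt_id _)
      (hasDerivAt_const _ _) (hasDerivAt_const _ _)).deriv
  have h2 : pd3_x u (a s) (b s) (c s) = _ :=
    (key (fun _ => a s) (fun r => r) (fun _ => c s) 0 1 0 (b s) (hasDerivAt_const _ _)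
      (hasDerivAt_id _) (hasDerivAt_const _ _)).deriv
  have h3 : pd3_y u (a s) (b s) (c s) = _ :=
    (key (fun _ => a s) (fun _ => b s) (fun r => r) 0 0 1 (c s) (hasDerivAt_const _ _)
      (hasDerivAt_const _ _) (hasDerivAt_id _)).deriv
  convert key a b c a' b' c' s ha hb hc using 1
  rw [h1, h2, h3]
  simp only [← smul_eq_mul, ← map_smul, ← map_add]
  congr 1
  simp

/-- With θ = u·N the normal speed and Z = ∂ₜu + (u·∇)u the material
derivative, if ∂ₜf = θ then along x₂ = f(t,x₁) one has
Z·N = ∂ₜθ + 2u₁∂₁θ + u₁²∂₁∂₁f. -/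
theorem stmt_17 (f : ℝ → ℝ → ℝ) (u1 u2 : ℝ → ℝ → ℝ → ℝ)
    (hf : ContDiff ℝ 2 (fun p : ℝ × ℝ => f p.1 p.2))
    (hu1 : ContDiff ℝ 1 (fun p : ℝ × ℝ × ℝ => u1 p.1 p.2.1 p.2.2))
    (hu2 : ContDiff ℝ 1 (fun p : ℝ × ℝ × ℝ => u2 p.1 p.2.1 p.2.2))
    (θ : ℝ → ℝ → ℝ)
    (hθ : ∀ t x, θ t x = u2 t x (f t x) - u1 t x (f t x) * pd_x f t x)
    (Z1 Z2 : ℝ → ℝ → ℝ → ℝ)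
    (hZ1 : ∀ t x y, Z1 t x y =
      pd3_t u1 t x y + u1 t x y * pd3_x u1 t x y + u2 t x y * pd3_y u1 t x y)
    (hZ2 : ∀ t x y, Z2 t x y =
      pd3_t u2 t x y + u1 t x y * pd3_x u2 t x y + u2 t x y * pd3_y u2 t x y)
    (hbc : ∀ t x, pd_t f t x = θ t x) :
    ∀ t x : ℝ,
      Z2 t x (f t x) - pd_x f t x * Z1 t x (f t x)
        = pd_t θ t x + 2 * u1 t x (f t x) * pd_x θ t x
            + (u1 t x (f t x)) ^ 2 * pd_x (fun a b => pd_x f a b) t x := by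
  intro t x
  have d1 := hu1.differentiable one_ne_zero
  have d2 := hu2.differentiable one_ne_zero
  have dF := hf.differentiable two_ne_zero
  have dG : Differentiable ℝ (fderiv ℝ (fun p : ℝ × ℝ => f p.1 p.2)) :=
    (hf.fderiv_right (m := 1) (by norm_num)).differentiable one_ne_zero
  have ht : ∀ t x, HasDerivAt (fun s => f s x) (pd_t f t x) t := fun t x =>
    (aux_t _ t x (dF (t, x))).differentiableAt.hasDerivAt
  have hx : ∀ t x, HasDerivAt (fun s => f t s) (pd_x f t x) x := fun t x =>
    (aux_x _ t x (dF (t, x))).differentiableAt.hasDerivAt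
  have et : ∀ t x, pd_t f t x = fderiv ℝ (fun p : ℝ × ℝ => f p.1 p.2) (t, x) (1, 0) := fun t x =>
    (aux_t _ t x (dF (t, x))).deriv
  have ex : ∀ t x, pd_x f t x = fderiv ℝ (fun p : ℝ × ℝ => f p.1 p.2) (t, x) (0, 1) := fun t x =>
    (aux_x _ t x (dF (t, x))).deriv
  have hsymm : IsSymmSndFDerivAt ℝ (fun p : ℝ × ℝ => f p.1 p.2) (t, x) :=
    hf.contDiffAt.isSymmSndFDerivAt (by simp)
  -- mixed second derivatives
  have hxt : HasDerivAt (fun s => pd_x f s x) (pd_x θ t x) t := by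
    have h1 : HasDerivAt (fun s => pd_x f s x)
        (fderiv ℝ (fderiv ℝ (fun p : ℝ × ℝ => f p.1 p.2)) (t, x) (1, 0) (0, 1)) t := by
      simp only [ex]
      simpa using (aux_t _ t x (dG (t, x))).clm_apply (hasDerivAt_const t ((0, 1) : ℝ × ℝ))
    have h2 : HasDerivAt (fun s => θ t s)
        (fderiv ℝ (fderiv ℝ (fun p : ℝ × ℝ => f p.1 p.2)) (t, x) (0, 1) (1, 0)) x := by
      simp only [← hbc, et]
      simpa using (aux_x _ t x (dG (t, x))).clm_apply (hasDerivAt_const x ((1, 0) : ℝ × ℝ))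
    have h3 : pd_x θ t x = _ := h2.deriv
    rw [h3]
    convert h1 using 1
    exact hsymm _ _
  have hxx : HasDerivAt (fun s => pd_x f t s) (pd_x (fun a b => pd_x f a b) t x) x := by
    have h1 : HasDerivAt (fun s => pd_x f t s)
        (fderiv ℝ (fderiv ℝ (fun p : ℝ × ℝ => f p.1 p.2)) (t, x) (0, 1) (0, 1)) x := by
      simp only [ex]
      simpa using (aux_x _ t x (dG (t, x))).clm_apply (hasDerivAt_const x ((0, 1) : ℝ × ℝ))
    exact h1.differentiableAt.hasDerivAt
  have c1t := aux_chain u1 d1 (fun s => s) (fun _ => x) (fun s => f s x) 1 0 _ t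
    (hasDerivAt_id _) (hasDerivAt_const _ _) (ht t x)
  have c2t := aux_chain u2 d2 (fun s => s) (fun _ => x) (fun s => f s x) 1 0 _ t
    (hasDerivAt_id _) (hasDerivAt_const _ _) (ht t x)
  have c1x := aux_chain u1 d1 (fun _ => t) (fun s => s) (fun s => f t s) 0 1 _ x
    (hasDerivAt_const _ _) (hasDerivAt_id _) (hx t x)
  have c2x := aux_chain u2 d2 (fun _ => t) (fun s => s) (fun s => f t s) 0 1 _ x
    (hasDerivAt_const _ _) (hasDerivAt_id _) (hx t x)
  have T := (c2t.sub (c1t.mul hxt)).deriv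
  have T' : pd_t θ t x = deriv ((fun r => u2 r x (f r x)) -
      (fun r => u1 r x (f r x)) * fun s => pd_x f s x) t := by
    rw [pd_t]
    congr 1
    funext s; exact hθ s x
  have X := (c2x.sub (c1x.mul hxx)).deriv
  have X' : pd_x θ t x = deriv ((fun r => u2 t r (f t r)) -
      (fun r => u1 t r (f t r)) * fun s => pd_x f t s) x := by
    rw [pd_x]
    congr 1
    funext s; exact hθ t s
  rw [← T'] at T
  rw [← X'] at X
  have B := hbc t x
  rw [hθ] at B
  rw [hZ1, hZ2, T]
  rw [B]
  linear_combination (-u1 t x (f t x)) * X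
end
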